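/- arXiv:1607.06163 — 2 statements merged into one kernel-verified Lean document; each statement's English description precedes it below -/
import Mathlib

section
/- Let (Ω,ℱ,P) be a probability space, d, q ≥ 1, and for each T ∈ ℕ let Q_T : Ω × ℝ^d → ℝ be such that Q_T(ω,·) is twice continuously differentiable for every ω with measurable gradient and Hessian; let β̂ʳ_T : Ω → ℝ^d and λ̂_T : Ω → ℝ^q be measurable, β⁰_T ∈ ℝ^d deterministic with β⁰_T → β⁰ ∈ ℝ^d, and let g : ℝ^d → ℝ^q be continuously differentiable with Jacobian Dg. Assume: (i) √T ∇Q_T(·,β⁰_T) is bounded in probability; (ii) there exists a symmetric positive definite d×d matrix J⁰ such that for every γ > 0, sup over {β : ‖β − β⁰_T‖ ≤ γ/√T} of ‖∇²Q_T(·,β) + J⁰‖ converges to 0 in probability; (iii) √T(β̂ʳ_T − β⁰_T) and √T λ̂_T are bounded in probability; (iv) the Kuhn–Tucker first-order condition ∇Q_T(·, β̂ʳ_T) + Dg(β̂ʳ_T)ᵀ λ̂_T = 0 holds almost surely for every T. Then, with J_T := −∇²Q_T(·, β⁰_T), the sequence J_T √T(β̂ʳ_T − β⁰_T) − Dg(β⁰_T)ᵀ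 √T λ̂_T − √T ∇Q_T(·, β⁰_T) converges to 0 in probability. -/
open MeasureTheory Filter Matrix

attribute [local instance] Matrix.normedAddCommGroup

/-- The gradient of `f : ℝ^d → ℝ` at `x`, as a vector of partial derivatives. -/
noncomputable def gradOf {d : ℕ} (f : (Fin d → ℝ) → ℝ) (x : Fin d → ℝ) : Fin d → ℝ :=
  fun i => fderiv ℝ f x (Pi.single i 1)

/-- The Hessian matrix of `f : ℝ^d → ℝ` at `x`. -/
noncomputable def hessOf {d : ℕ} (f : (Fin d → ℝ) → ℝ) (x : Fin d → ℝ) :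
    Matrix (Fin d) (Fin d) ℝ :=
  Matrix.of fun i j =>
    fderiv ℝ (fun y => fderiv ℝ f y (Pi.single j 1)) x (Pi.single i 1)

/-- The `q × d` Jacobian matrix of `g : ℝ^d → ℝ^q` at `x`. -/
noncomputable def jacOf {d q : ℕ} (g : (Fin d → ℝ) → (Fin q → ℝ)) (x : Fin d → ℝ) :
    Matrix (Fin q) (Fin d) ℝ :=
  Matrix.of fun i j => fderiv ℝ (fun y => g y i) x (Pi.single j 1)

/-- A sequence of random vectors is bounded in probability: for every `ε > 0` there is
`M > 0` with `P(‖Z_T‖ > M) < ε` for all `T`. -/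
def BoundedInProb {Ω E : Type*} [MeasurableSpace Ω] [Norm E]
    (P : Measure Ω) (Z : ℕ → Ω → E) : Prop :=
  ∀ ε : ℝ, 0 < ε → ∃ M : ℝ, 0 < M ∧ ∀ T : ℕ, P {ω | M < ‖Z T ω‖} < ENNReal.ofReal ε

/-- A sequence of random vectors converges to `0` in probability:
`P(‖Z_T‖ > ε) → 0` for every `ε > 0`. -/
def TendstoInProbZero {Ω E : Type*} [MeasurableSpace Ω] [Norm E]
    (P : Measure Ω) (Z : ℕ → Ω → E) : Prop :=
  ∀ ε : ℝ, 0 < ε → Tendsto (fun T : ℕ => P {ω | ε < ‖Z T ω‖}) atTop (nhds 0)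

/-- The entrywise sup norm controls `mulVec` up to the number of columns. -/
lemma norm_mulVec_le_card_mul {m n : ℕ} (A : Matrix (Fin m) (Fin n) ℝ) (v : Fin n → ℝ) :
    ‖A.mulVec v‖ ≤ n * ‖A‖ * ‖v‖ := by
  refine (pi_norm_le_iff_of_nonneg (by positivity)).2 fun i => ?_
  calc ‖A.mulVec v i‖ ≤ ∑ j, ‖A i j * v j‖ :=
        norm_sum_le Finset.univ fun j => A i j * v j
    _ ≤ ∑ _j : Fin n, ‖A‖ * ‖v‖ := by
        gcongr with j
        rw [norm_mul]
        gcongr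
        · exact A.norm_entry_le_entrywise_sup_norm
        · exact norm_le_pi_norm v j
    _ = n * ‖A‖ * ‖v‖ := by simp [mul_assoc]

lemma hasFDerivAt_gradOf {d : ℕ} {f : (Fin d → ℝ) → ℝ} (hf : ContDiff ℝ 2 f)
    (x : Fin d → ℝ) :
    HasFDerivAt (gradOf f) (LinearMap.toContinuousLinearMap (hessOf f x)ᵀ.mulVecLin) x := by
  refine hasFDerivAt_pi'.2 fun i => ?_
  have hdiff : DifferentiableAt ℝ (fun y => fderiv ℝ f y (Pi.single i 1)) x :=
    ((hf.fderiv_right (m := 1) (by norm_num)).clm_apply contDiff_const).differentiable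
      (by norm_num) x
  refine hdiff.hasFDerivAt.congr_fderiv (ContinuousLinearMap.coe_injective ?_)
  refine LinearMap.pi_ext' fun j => LinearMap.ext_ring ?_
  simp [hessOf]

/-- A mean value estimate: if the Hessian stays close to `-J` on a ball, then the gradient is
nearly affine with slope `-Jᵀ` there. -/
lemma norm_gradOf_sub_add_mulVec_le {d : ℕ} {f : (Fin d → ℝ) → ℝ} (hf : ContDiff ℝ 2 f)
    {J : Matrix (Fin d) (Fin d) ℝ} {x y : Fin d → ℝ} {r c : ℝ} (hy : ‖y - x‖ ≤ r)
    (hJ : ∀ z, ‖z - x‖ ≤ r → ‖hessOf f z + J‖ ≤ c) :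
    ‖gradOf f y - gradOf f x + Jᵀ.mulVec (y - x)‖ ≤ d * c * ‖y - x‖ := by
  have hr : 0 ≤ r := (norm_nonneg _).trans hy
  have hc : 0 ≤ c := (norm_nonneg _).trans (hJ x (by simpa using hr))
  have hderiv (z : Fin d → ℝ) : HasFDerivAt (fun z => gradOf f z + Jᵀ.mulVec z)
      (LinearMap.toContinuousLinearMap (hessOf f z + J)ᵀ.mulVecLin) z := by
    refine ((hasFDerivAt_gradOf hf z).add
      (LinearMap.toContinuousLinearMap Jᵀ.mulVecLin).hasFDerivAt).congr_fderiv ?_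
    ext v : 1
    simp
  have key := (convex_closedBall x r).norm_image_sub_le_of_norm_hasFDerivWithin_le
    (C := d * c) (fun z _ => (hderiv z).hasFDerivWithinAt)
    (fun z hz => ContinuousLinearMap.opNorm_le_bound _ (by positivity) fun v => ?_)
    (Metric.mem_closedBall_self hr) (by simpa [dist_eq_norm] using hy : y ∈ _)
  · rwa [Matrix.mulVec_sub, sub_add_sub_comm]
  · refine (norm_mulVec_le_card_mul (hessOf f z + J)ᵀ v).trans ?_
    rw [Matrix.norm_transpose]
    gcongr
    exact hJ z (by simpa [dist_eq_norm] using hz)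

lemma continuous_jacOf {d q : ℕ} {g : (Fin d → ℝ) → (Fin q → ℝ)} (hg : ContDiff ℝ 1 g) :
    Continuous (jacOf g) :=
  continuous_matrix fun i j =>
    ((contDiff_pi.1 hg i).continuous_fderiv (by norm_num)).clm_apply continuous_const

/-- A continuous map oscillates little on balls of vanishing radius with convergent centers. -/
lemma eventually_norm_sub_le_of_continuous {E F : Type*} [SeminormedAddCommGroup E]
    [SeminormedAddCommGroup F] {f : E → F} (hf : Continuous f) {c : ℕ → E} {l : E}
    (hc : Tendsto c atTop (nhds l)) {r : ℕ → ℝ} (hr : Tendsto r atTop (nhds 0))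
    {δ : ℝ} (hδ : 0 < δ) :
    ∀ᶠ T in atTop, ∀ x, ‖x - c T‖ ≤ r T → ‖f x - f (c T)‖ ≤ δ := by
  obtain ⟨ρ, hρ, hball⟩ := Metric.continuousAt_iff.1 hf.continuousAt (δ / 2) (half_pos hδ)
  filter_upwards [hc (Metric.ball_mem_nhds l (half_pos hρ)),
    hr.eventually_lt_const (half_pos hρ)] with T hcT hrT x hx
  have hcl : dist (c T) l < ρ / 2 := hcT
  have hxc : dist x (c T) ≤ r T := by rwa [dist_eq_norm]
  have h₁ := hball (x := x) (by linarith [dist_triangle x (c T) l])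
  have h₂ := hball (x := c T) (by linarith)
  rw [← dist_eq_norm]
  linarith [dist_triangle_right (f x) (f (c T)) (f l)]

/-- The pathwise estimate behind the linear expansion of the Kuhn–Tucker conditions. -/
lemma norm_kuhnTucker_expansion_le {d q : ℕ} {f : (Fin d → ℝ) → ℝ} (hf : ContDiff ℝ 2 f)
    {J : Matrix (Fin d) (Fin d) ℝ} (hJsymm : Jᵀ = J) {x y : Fin d → ℝ} {l : Fin q → ℝ}
    {G₀ G : Matrix (Fin q) (Fin d) ℝ} (hKT : gradOf f y + Gᵀ.mulVec l = 0)
    {n r c δ M₁ M₂ : ℝ} (hy : ‖y - x‖ ≤ r)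
    (hJ : ∀ z, ‖z - x‖ ≤ r → ‖hessOf f z + J‖ ≤ c) (hG : ‖G - G₀‖ ≤ δ)
    (h₁ : ‖n • (y - x)‖ ≤ M₁) (h₂ : ‖n • l‖ ≤ M₂) :
    ‖(-(hessOf f x)).mulVec (n • (y - x)) - G₀ᵀ.mulVec (n • l) - n • gradOf f x‖
      ≤ 2 * d * c * M₁ + q * δ * M₂ := by
  have hx : ‖hessOf f x + J‖ ≤ c := hJ x (by simpa using (norm_nonneg _).trans hy)
  have hc : 0 ≤ c := (norm_nonneg _).trans hx
  have hδ : 0 ≤ δ := (norm_nonneg _).trans hG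
  have hsplit : (-(hessOf f x)).mulVec (n • (y - x)) - G₀ᵀ.mulVec (n • l) - n • gradOf f x
      = n • (gradOf f y - gradOf f x + Jᵀ.mulVec (y - x))
        - (hessOf f x + J).mulVec (n • (y - x)) + (G - G₀)ᵀ.mulVec (n • l) := by
    rw [eq_neg_of_add_eq_zero_left hKT, hJsymm]
    simp only [Matrix.neg_mulVec, Matrix.mulVec_smul, Matrix.add_mulVec, Matrix.transpose_sub,
      Matrix.sub_mulVec]
    module
  have hgrad : ‖n • (gradOf f y - gradOf f x + Jᵀ.mulVec (y - x))‖ ≤ d * c * M₁ := by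
    rw [norm_smul]
    calc ‖n‖ * _ ≤ ‖n‖ * (d * c * ‖y - x‖) := by
          gcongr; exact norm_gradOf_sub_add_mulVec_le hf hy hJ
      _ = d * c * ‖n • (y - x)‖ := by rw [norm_smul]; ring
      _ ≤ d * c * M₁ := by gcongr
  have hhess : ‖(hessOf f x + J).mulVec (n • (y - x))‖ ≤ d * c * M₁ :=
    (norm_mulVec_le_card_mul _ _).trans (by gcongr)
  have hjac : ‖(G - G₀)ᵀ.mulVec (n • l)‖ ≤ q * δ * M₂ :=
    (norm_mulVec_le_card_mul _ _).trans (by rw [Matrix.norm_transpose]; gcongr)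
  rw [hsplit]
  linarith [norm_add_le (n • (gradOf f y - gradOf f x + Jᵀ.mulVec (y - x))
      - (hessOf f x + J).mulVec (n • (y - x))) ((G - G₀)ᵀ.mulVec (n • l)),
    norm_sub_le (n • (gradOf f y - gradOf f x + Jᵀ.mulVec (y - x)))
      ((hessOf f x + J).mulVec (n • (y - x)))]

/-- Proposition 1 of the paper. Under the stated regularity and
boundedness-in-probability conditions, and the Kuhn–Tucker first-order condition
`∇Q_T(β̂ʳ_T) + Dg(β̂ʳ_T)ᵀ λ̂_T = 0` (a.s.), the sequence
`J_T √T(β̂ʳ_T − β⁰_T) − Dg(β⁰_T)ᵀ √T λ̂_T − √T ∇Q_T(β⁰_T)` converges to `0` in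
probability, where `J_T = −∇²Q_T(β⁰_T)`. -/
theorem stmt5 {Ω : Type*} [MeasurableSpace Ω] (P : Measure Ω) [IsProbabilityMeasure P]
    {d q : ℕ} (hd : 1 ≤ d) (hq : 1 ≤ q)
    (Q : ℕ → Ω → (Fin d → ℝ) → ℝ)
    (hC2 : ∀ T ω, ContDiff ℝ 2 (Q T ω))
    (hmeas_grad : ∀ T (β : Fin d → ℝ), Measurable fun ω => gradOf (Q T ω) β)
    (hmeas_hess : ∀ T (β : Fin d → ℝ) i j, Measurable fun ω => hessOf (Q T ω) β i j)
    (βr : ℕ → Ω → Fin d → ℝ) (hβr : ∀ T, Measurable (βr T))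
    (lam : ℕ → Ω → Fin q → ℝ) (hlam : ∀ T, Measurable (lam T))
    (β0 : ℕ → Fin d → ℝ) (β0lim : Fin d → ℝ) (hβ0 : Tendsto β0 atTop (nhds β0lim))
    (g : (Fin d → ℝ) → (Fin q → ℝ)) (hg : ContDiff ℝ 1 g)
    (J0 : Matrix (Fin d) (Fin d) ℝ) (hJ0 : J0.PosDef)
    (hi : BoundedInProb P fun T ω => Real.sqrt T • gradOf (Q T ω) (β0 T))
    (hii : ∀ γ : ℝ, 0 < γ → ∀ ε : ℝ, 0 < ε →
      Tendsto (fun T : ℕ => P {ω | ∃ β : Fin d → ℝ,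
          ‖β - β0 T‖ ≤ γ / Real.sqrt T ∧ ε < ‖hessOf (Q T ω) β + J0‖})
        atTop (nhds 0))
    (hiii : BoundedInProb P fun T ω => Real.sqrt T • (βr T ω - β0 T))
    (hiii' : BoundedInProb P fun T ω => Real.sqrt T • lam T ω)
    (hKT : ∀ T : ℕ, ∀ᵐ ω ∂P,
      gradOf (Q T ω) (βr T ω) + (jacOf g (βr T ω))ᵀ.mulVec (lam T ω) = 0) :
    TendstoInProbZero P fun T ω =>
      (-(hessOf (Q T ω) (β0 T))).mulVec (Real.sqrt T • (βr T ω - β0 T)) -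
        (jacOf g (β0 T))ᵀ.mulVec (Real.sqrt T • lam T ω) -
        Real.sqrt T • gradOf (Q T ω) (β0 T) := by
  have hJsymm : J0ᵀ = J0 := by simpa using hJ0.isHermitian.eq
  intro η hη
  refine ENNReal.tendsto_nhds_zero.2 fun p hp => ?_
  obtain ⟨r, hr, hrp⟩ : ∃ r : ℝ, 0 < r ∧ 3 * ENNReal.ofReal r ≤ p := by
    obtain ⟨s, hs, hsp⟩ := ENNReal.lt_iff_exists_nnreal_btwn.1 hp
    have hs' : (0 : ℝ) < s := by exact_mod_cast hs
    refine ⟨s / 3, by positivity, le_trans (le_of_eq ?_) hsp.le⟩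
    rw [← ENNReal.ofReal_ofNat, ← ENNReal.ofReal_mul (by norm_num), mul_div_cancel₀ _ (by norm_num),
      ENNReal.ofReal_coe_nnreal]
  obtain ⟨M₁, hM₁, hP₁⟩ := hiii r hr
  obtain ⟨M₂, hM₂, hP₂⟩ := hiii' r hr
  have hd' : (0 : ℝ) < d := by exact_mod_cast hd
  have hq' : (0 : ℝ) < q := by exact_mod_cast hq
  set c : ℝ := η / (4 * d * M₁) with hc_def
  set δ : ℝ := η / (2 * q * M₂) with hδ_def
  have hc : 0 < c := by positivity
  have hδ : 0 < δ := by positivity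
  have hbudget : 2 * d * c * M₁ + q * δ * M₂ = η := by
    rw [hc_def, hδ_def]
    field_simp
    ring
  have hradius : Tendsto (fun T : ℕ => M₁ / Real.sqrt T) atTop (nhds 0) :=
    (Real.tendsto_sqrt_atTop.comp tendsto_natCast_atTop_atTop).const_div_atTop M₁
  filter_upwards [ENNReal.tendsto_nhds_zero.1 (hii M₁ hM₁ c hc) _ (ENNReal.ofReal_pos.2 hr),
    eventually_norm_sub_le_of_continuous (continuous_jacOf hg) hβ0 hradius hδ,
    eventually_gt_atTop 0] with T hPhess hjac hT
  have hsqrt : 0 < Real.sqrt T := Real.sqrt_pos.2 (by exact_mod_cast hT)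
  refine (measure_mono_ae (t := {ω | M₁ < ‖Real.sqrt T • (βr T ω - β0 T)‖} ∪
    {ω | M₂ < ‖Real.sqrt T • lam T ω‖} ∪ {ω | ∃ β : Fin d → ℝ,
      ‖β - β0 T‖ ≤ M₁ / Real.sqrt T ∧ c < ‖hessOf (Q T ω) β + J0‖}) ?_).trans ?_
  · filter_upwards [hKT T] with ω hω
    refine fun hbad : η < _ => ?_
    by_contra hgood
    have hgood' : ¬ ((M₁ < ‖Real.sqrt T • (βr T ω - β0 T)‖ ∨ M₂ < ‖Real.sqrt T • lam T ω‖) ∨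
      ∃ β : Fin d → ℝ, ‖β - β0 T‖ ≤ M₁ / Real.sqrt T ∧ c < ‖hessOf (Q T ω) β + J0‖) := hgood
    push Not at hgood'
    obtain ⟨⟨h₁, h₂⟩, hhess⟩ := hgood'
    have hy : ‖βr T ω - β0 T‖ ≤ M₁ / Real.sqrt T := by
      rwa [le_div_iff₀' hsqrt, ← Real.norm_of_nonneg hsqrt.le, ← norm_smul]
    exact hbad.not_ge (hbudget ▸ norm_kuhnTucker_expansion_le (hC2 T ω) hJsymm hω hy
      hhess (hjac _ hy) h₁ h₂)
  · calc _ ≤ ENNReal.ofReal r + ENNReal.ofReal r + ENNReal.ofReal r :=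
          (measure_union_le _ _).trans (add_le_add ((measure_union_le _ _).trans
            (add_le_add (hP₁ T).le (hP₂ T).le)) hPhess)
      _ = 3 * ENNReal.ofReal r := by ring
      _ ≤ p := hrp
end

section
/- Let V be a q×q real symmetric positive definite matrix, Γ_θ a q×k real matrix, and C a q×(p−k) real matrix (k ≤ p ≤ q), and let A* be the p×q matrix whose first k rows are the rows of Γ_θᵀ V⁻¹ and whose last p−k rows are the rows of Cᵀ. If A* has full row rank p, then A* V A*ᵀ is invertible and Γ_θᵀ A*ᵀ (A* V A*ᵀ)⁻¹ A* Γ_θ = Γ_θᵀ V⁻¹ Γ_θ. -/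
open Matrix

theorem Matrix.linearIndependent_row_of_rank_eq_card {m n K : Type*} [Fintype m] [Fintype n]
    [Field K] {A : Matrix m n K} (hA : A.rank = Fintype.card m) : LinearIndependent K A.row := by
  rw [linearIndependent_iff_card_eq_finrank_span, ← hA, A.rank_eq_finrank_span_row]
  rfl

theorem Matrix.PosDef.mul_mul_transpose_of_rank_eq_card {m n : Type*} [Fintype m] [Fintype n]
    {V : Matrix n n ℝ} (hV : V.PosDef) {A : Matrix m n ℝ} (hA : A.rank = Fintype.card m) :
    (A * V * Aᵀ).PosDef := by
  simpa using hV.mul_mul_conjTranspose_same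
    (vecMul_injective_iff.2 (linearIndependent_row_of_rank_eq_card hA))

/-- attainment claim of Theorem 6(ii). With `p = k + r` (`p ≤ q`),
let `A* : p × q` be obtained by stacking `Γ_θᵀV⁻¹` (first `k` rows) on top of `Cᵀ`
(last `r = p − k` rows). If `A*` has full row rank `p`, then `A* V A*ᵀ` is invertible
and `Γ_θᵀ A*ᵀ (A* V A*ᵀ)⁻¹ A* Γ_θ = Γ_θᵀ V⁻¹ Γ_θ`. -/
theorem stmt11 {q k r : ℕ} (hpq : k + r ≤ q)
    (V : Matrix (Fin q) (Fin q) ℝ) (hV : V.PosDef)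
    (Γθ : Matrix (Fin q) (Fin k) ℝ) (C : Matrix (Fin q) (Fin r) ℝ) :
    let Astar : Matrix (Fin k ⊕ Fin r) (Fin q) ℝ := Matrix.fromRows (Γθᵀ * V⁻¹) Cᵀ
    Astar.rank = k + r →
    IsUnit (Astar * V * Astarᵀ) ∧
    Γθᵀ * Astarᵀ * (Astar * V * Astarᵀ)⁻¹ * Astar * Γθ = Γθᵀ * V⁻¹ * Γθ := by
  intro Astar hrank
  have hM : IsUnit (Astar * V * Astarᵀ) :=
    (hV.mul_mul_transpose_of_rank_eq_card (by simpa using hrank)).isUnit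
  refine ⟨hM, ?_⟩
  have hMdet := (isUnit_iff_isUnit_det _).1 hM
  have hVdet : IsUnit V.det := (isUnit_iff_isUnit_det _).1 hV.isUnit
  have hVt : Vᵀ = V := by simpa using hV.isHermitian.eq
  let E : Matrix (Fin k ⊕ Fin r) (Fin k) ℝ := Matrix.fromRows 1 0
  have hE : Astarᵀ * E = V⁻¹ * Γθ := by
    simp [Astar, E, transpose_fromRows, fromCols_mul_fromRows, transpose_nonsing_inv, hVt]
  have hΓ : Astar * Γθ = Astar * V * Astarᵀ * E := by
    rw [Matrix.mul_assoc _ Astarᵀ, hE, Matrix.mul_assoc, mul_nonsing_inv_cancel_left _ _ hVdet]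
  rw [Matrix.mul_assoc _ Astar, hΓ, Matrix.mul_assoc _ _⁻¹,
    nonsing_inv_mul_cancel_left _ _ hMdet, Matrix.mul_assoc, hE, Matrix.mul_assoc]
end
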